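/- Let X₁, X₂, … be i.i.d. real random variables with cdf F and let F̂_t denote the empirical cdf based on X₁,…,X_t. Then for every t∈ℕ and every s>0: E[ exp( s·t·‖F̂_t − F‖_∞ ) ] ≤ 1 + √(2π)·s·√t·e^{s²t/8}; moreover, for every k>0, E[ exp( s·t·‖F̂_t − F‖_∞ ) ] ≤ (1 + 2√(2πk/e))·e^{(1+1/k)s²t/8}. -/

import Mathlib

open MeasureTheory Set

noncomputable section

namespace TRDT

/-- Kolmogorov (supremum) distance `‖F - G‖_∞`. -/
def supDist (F G : ℝ → ℝ) : ℝ := ⨆ x : ℝ, |F x - G x|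

/-- The cdf of a (probability) measure `μ` on `ℝ`. -/
def cdfOf (μ : Measure ℝ) : ℝ → ℝ := fun x => (μ (Set.Iic x)).toReal

/-- The empirical cdf of the sample `ω : Fin t → ℝ`. -/
def empiricalCdf {t : ℕ} (ω : Fin t → ℝ) : ℝ → ℝ :=
  fun x => (∑ s : Fin t, if ω s ≤ x then (1 : ℝ) else 0) / t


lemma sinh_le_mul_cosh {l : ℝ} (hl : 0 ≤ l) : Real.sinh l ≤ l * Real.cosh l := by
  have hm : MonotoneOn (fun x : ℝ => x * Real.cosh x - Real.sinh x) (Set.Ici 0) := by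
    apply monotoneOn_of_deriv_nonneg (convex_Ici 0)
    · fun_prop
    · fun_prop
    · intro x hx
      rw [interior_Ici] at hx
      have h : HasDerivAt (fun x : ℝ => x * Real.cosh x - Real.sinh x)
          (1 * Real.cosh x + x * Real.sinh x - Real.cosh x) x :=
        ((hasDerivAt_id x).mul (Real.hasDerivAt_cosh x)).sub (Real.hasDerivAt_sinh x)
      rw [h.deriv]
      have : 0 ≤ x * Real.sinh x := mul_nonneg (le_of_lt hx) (Real.sinh_nonneg_iff.2 (le_of_lt hx))
      linarith
  have := hm (Set.mem_Ici.2 le_rfl) (Set.mem_Ici.2 hl) hl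
  simp at this
  linarith

lemma coth_bd {l : ℝ} (hl : 0 < l) :
    0 ≤ l * Real.cosh l / Real.sinh l - 1 ∧
      l * Real.cosh l / Real.sinh l - 1 ≤ Real.cosh l - 1 := by
  have hS : 0 < Real.sinh l := Real.sinh_pos_iff.2 hl
  have h1 := sinh_le_mul_cosh hl.le
  have h2 : l ≤ Real.sinh l := Real.self_le_sinh_iff.2 hl.le
  have h3 := Real.one_le_cosh l
  constructor
  · rw [sub_nonneg, le_div_iff₀ hS]; linarith
  · apply sub_le_sub_right
    rw [div_le_iff₀ hS]
    nlinarith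

lemma key_hyp {l : ℝ} (hl : 0 < l) :
    2 * Real.log (Real.cosh l) ≤ l ^ 2 - (l * Real.cosh l / Real.sinh l - 1) ^ 2 := by
  set G : ℝ → ℝ := fun x => x ^ 2 - (x * Real.cosh x / Real.sinh x - 1) ^ 2
    - 2 * Real.log (Real.cosh x) with hG
  have hd : ∀ x : ℝ, 0 < x → HasDerivAt G (2 * x - 2 * (x * Real.cosh x / Real.sinh x - 1) *
      (((1 * Real.cosh x + x * Real.sinh x) * Real.sinh x - x * Real.cosh x * Real.cosh x)
        / Real.sinh x ^ 2) - 2 * (Real.sinh x / Real.cosh x)) x := by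
    intro x hx
    have hS : 0 < Real.sinh x := Real.sinh_pos_iff.2 hx
    have a1 := ((((hasDerivAt_id x).mul (Real.hasDerivAt_cosh x)).div (Real.hasDerivAt_sinh x)
      hS.ne').sub_const 1).pow 2
    have a2 := ((Real.hasDerivAt_cosh x).log (Real.cosh_pos x).ne').const_mul 2
    have a3 := ((hasDerivAt_pow 2 x).sub a1).sub a2
    refine HasDerivAt.congr_deriv (f := G) a3 ?_
    simp
  have hm : MonotoneOn G (Set.Ioi 0) := by
    apply monotoneOn_of_deriv_nonneg (convex_Ioi 0)
    · exact fun x hx => (hd x hx).continuousAt.continuousWithinAt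
    · rw [interior_Ioi]
      exact fun x hx => (hd x hx).differentiableAt.differentiableWithinAt
    · intro x hx
      rw [interior_Ioi] at hx
      rw [(hd x hx).deriv]
      have hS : 0 < Real.sinh x := Real.sinh_pos_iff.2 hx
      have hC := Real.cosh_pos x
      have h1 := sinh_le_mul_cosh (le_of_lt hx)
      have h2 := Real.cosh_sq x
      have : 2 * x - 2 * (x * Real.cosh x / Real.sinh x - 1) *
        (((1 * Real.cosh x + x * Real.sinh x) * Real.sinh x - x * Real.cosh x * Real.cosh x)
        / Real.sinh x ^ 2) - 2 * (Real.sinh x / Real.cosh x)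
        = 2 * (x * Real.cosh x - Real.sinh x) ^ 2 / (Real.cosh x * Real.sinh x ^ 3) := by
        field_simp
        generalize Real.sinh x = S at *
        generalize Real.cosh x = C at *
        have e : C ^ 2 - S ^ 2 = 1 := by linarith
        linear_combination (x ^ 2 * C ^ 2 - 2 * x * S * C + S ^ 2) * e
      rw [this]
      positivity
  have hlim : Filter.Tendsto (fun e : ℝ => - (Real.cosh e - 1) ^ 2 - 2 * Real.log (Real.cosh e))
      (nhdsWithin 0 (Set.Ioi 0)) (nhds 0) := by
    have : ContinuousAt (fun e : ℝ => - (Real.cosh e - 1) ^ 2 - 2 * Real.log (Real.cosh e)) 0 := by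
      have := (Real.continuous_cosh.continuousAt (x := 0)).log (Real.cosh_pos 0).ne'
      have h2 := Real.continuous_cosh.continuousAt (x := 0)
      exact ((h2.sub continuousAt_const).pow 2).neg.sub (continuousAt_const.mul this)
    have h := this.tendsto
    simp at h
    exact h.mono_left nhdsWithin_le_nhds
  have : 0 ≤ G l := by
    apply le_of_tendsto hlim
    have : Set.Ioo (0:ℝ) l ∈ nhdsWithin (0:ℝ) (Set.Ioi 0) := Ioo_mem_nhdsGT hl
    filter_upwards [this] with e he
    refine le_trans ?_ (hm he.1 hl he.2.le)
    have := coth_bd he.1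
    simp only [hG]
    have : (e * Real.cosh e / Real.sinh e - 1) ^ 2 ≤ (Real.cosh e - 1) ^ 2 :=
      pow_le_pow_left₀ this.1 this.2 2
    nlinarith [sq_nonneg e]
  simp only [hG] at this
  linarith

lemma exists_l {a : ℝ} (ha : 0 < a) :
    ∃ l : ℝ, 0 < l ∧ l - 1 + l * Real.cosh l / Real.sinh l = a := by
  have hlim : Filter.Tendsto (fun e : ℝ => e + (Real.cosh e - 1))
      (nhdsWithin 0 (Set.Ioi 0)) (nhds 0) := by
    have : Continuous (fun e : ℝ => e + (Real.cosh e - 1)) := by fun_prop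
    have h := this.tendsto 0
    simp at h
    exact h.mono_left nhdsWithin_le_nhds
  have h1 : ∀ᶠ e in nhdsWithin (0:ℝ) (Set.Ioi 0), e + (Real.cosh e - 1) < a :=
    hlim.eventually_lt_const ha
  have h2 : Set.Ioo (0:ℝ) a ∈ nhdsWithin (0:ℝ) (Set.Ioi 0) := Ioo_mem_nhdsGT ha
  obtain ⟨e, he1, he2⟩ := (h1.and h2).exists
  have hc : ContinuousOn (fun l : ℝ => l - 1 + l * Real.cosh l / Real.sinh l) (Set.Icc e a) := by
    apply ContinuousOn.add (by fun_prop)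
    apply ContinuousOn.div (by fun_prop) (by fun_prop)
    intro x hx
    exact (Real.sinh_pos_iff.2 (he2.1.trans_le hx.1)).ne'
  obtain ⟨l, hl, hl2⟩ := intermediate_value_Icc he2.2.le hc (show a ∈ _ from
    ⟨by have := (coth_bd he2.1).2; linarith,
     by have := (coth_bd ha).1; linarith⟩)
  exact ⟨l, he2.1.trans_le hl.1, hl2⟩

lemma phi_nonneg {x r : ℝ} (hx : 0 < x) (hr : 0 < r)
    (h1 : Real.log (1 + x) = x * (1 + r) / (1 + x)) (h2 : (1 + x) * (1 - r) ≤ 1 + r)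
    {w : ℝ} (hw : 0 ≤ w) :
    w * x * (1 + r) ^ 2 / ((1 + x) * (x + r * w)) ≤ Real.log (1 + w) := by
  set φ : ℝ → ℝ := fun w => Real.log (1 + w) - w * x * (1 + r) ^ 2 / ((1 + x) * (x + r * w)) with hφ
  have hd : ∀ w : ℝ, 0 ≤ w → HasDerivAt φ ((w - x) *
      (r ^ 2 * (1 + x) * w + x * ((1 + r) ^ 2 - (1 + x))) /
        ((1 + w) * (1 + x) * (x + r * w) ^ 2)) w := by
    intro w hw
    have hw1 : 0 < 1 + w := by linarith
    have hw2 : 0 < x + r * w := by positivity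
    have a1 := ((hasDerivAt_id w).const_add 1).log hw1.ne'
    have a2 := (((hasDerivAt_id w).mul_const x).mul_const ((1 + r) ^ 2)).div
      ((((hasDerivAt_id w).const_mul r).const_add x).const_mul (1 + x))
      (by simp only [id]; positivity)
    refine HasDerivAt.congr_deriv (f := φ) (a1.sub a2) ?_
    simp only [id]
    field_simp
    ring
  have hφx : φ x = 0 := by
    simp only [hφ, h1]; field_simp; ring
  have hφ0 : φ 0 = 0 := by simp [hφ]
  have hcont : ∀ s ⊆ Set.Ici (0:ℝ), ContinuousOn φ s := fun s hs y hy =>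
    (hd y (hs hy)).continuousAt.continuousWithinAt
  have hdiff : ∀ s ⊆ Set.Ici (0:ℝ), DifferentiableOn ℝ φ s := fun s hs y hy =>
    (hd y (hs hy)).differentiableAt.differentiableWithinAt
  have h3 : 0 ≤ r ^ 2 * (1 + x) * x + x * ((1 + r) ^ 2 - (1 + x)) := by
    have : (1 + x) * (1 - r) * (1 + r) ≤ (1 + r) * (1 + r) :=
      mul_le_mul_of_nonneg_right h2 (by linarith)
    have : 0 ≤ x * ((1 + r) * (1 + r) - (1 + x) * (1 - r) * (1 + r)) :=
      mul_nonneg hx.le (by linarith)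
    linarith
  suffices 0 ≤ φ w by simp only [hφ] at this; linarith
  rcases le_total x w with hxw | hxw
  · rw [← hφx]
    have hs : Set.Ici x ⊆ Set.Ici (0:ℝ) := Set.Ici_subset_Ici.2 hx.le
    refine monotoneOn_of_deriv_nonneg (convex_Ici x) (hcont _ hs)
      (hdiff _ (interior_subset.trans hs)) ?_ (Set.mem_Ici.2 le_rfl) hxw hxw
    intro y hy
    rw [interior_Ici] at hy
    have hy' : x < y := hy
    have hy0 : 0 < y := hx.trans hy
    rw [(hd y hy0.le).deriv]
    have : r ^ 2 * (1 + x) * x ≤ r ^ 2 * (1 + x) * y := by gcongr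
    apply div_nonneg (mul_nonneg (by linarith) (by linarith)) (by positivity)
  · rcases le_total 0 (r ^ 2 * (1 + x) * w + x * ((1 + r) ^ 2 - (1 + x))) with hq | hq
    · rw [← hφx]
      have hs : Set.Icc w x ⊆ Set.Ici (0:ℝ) := fun y hy => hw.trans hy.1
      refine antitoneOn_of_deriv_nonpos (convex_Icc w x) (hcont _ hs)
        (hdiff _ (interior_subset.trans hs)) ?_ ⟨le_rfl, hxw⟩ ⟨hxw, le_rfl⟩ hxw
      intro y hy
      rw [interior_Icc] at hy
      have hy0 : 0 ≤ y := hw.trans hy.1.le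
      rw [(hd y hy0).deriv]
      have : r ^ 2 * (1 + x) * w ≤ r ^ 2 * (1 + x) * y := by gcongr; exact hy.1.le
      apply div_nonpos_of_nonpos_of_nonneg _ (by positivity)
      exact mul_nonpos_of_nonpos_of_nonneg (by linarith [hy.2]) (by linarith)
    · rw [← hφ0]
      have hs : Set.Icc 0 w ⊆ Set.Ici (0:ℝ) := fun y hy => hy.1
      refine monotoneOn_of_deriv_nonneg (convex_Icc 0 w) (hcont _ hs)
        (hdiff _ (interior_subset.trans hs)) ?_ ⟨le_rfl, hw⟩ ⟨hw, le_rfl⟩ hw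
      intro y hy
      rw [interior_Icc] at hy
      rw [(hd y hy.1.le).deriv]
      have hy0 : 0 < y := hy.1
      have : r ^ 2 * (1 + x) * y ≤ r ^ 2 * (1 + x) * w := by gcongr; exact hy.2.le
      apply div_nonneg _ (by positivity)
      exact mul_nonneg_of_nonpos_of_nonpos (by linarith [hy.2]) (by linarith)

lemma exists_c {a : ℝ} (ha : 0 < a) :
    ∃ c : ℝ, 0 < c ∧ ∀ p : ℝ, 0 < p →
      2 * a ^ 2 + Real.log (1 + c) ≤ (p + a) * Real.log (1 + c / p) := by
  obtain ⟨l, hl, hr⟩ := exists_l (a := 2 * a) (by linarith)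
  have hS : 0 < Real.sinh l := Real.sinh_pos_iff.2 hl
  have hC := Real.cosh_pos l
  have hCS := Real.cosh_sq l
  have hE : Real.exp l = Real.cosh l + Real.sinh l := (Real.cosh_add_sinh l).symm
  have hbd := (coth_bd hl).1
  have hlC := sinh_le_mul_cosh hl.le
  have hkey := key_hyp hl
  set S := Real.sinh l
  set C := Real.cosh l
  set x := Real.exp (2 * l) - 1 with hxdef
  have hx1 : 1 + x = Real.exp l ^ 2 := by
    rw [hxdef, pow_two, ← Real.exp_add]; ring_nf
  have hEp := Real.exp_pos l
  have hEx : Real.exp l ^ 2 = 2 * (C * Real.exp l) - 1 := by rw [hE]; linear_combination -hCS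
  have hEx' : Real.exp l ^ 2 = 2 * (S * Real.exp l) + 1 := by rw [hE]; linear_combination hCS
  have hxS : x = 2 * (S * Real.exp l) := by linarith
  have hx : 0 < x := by rw [hxS]; positivity
  have hlog : Real.log (1 + x) = 2 * l := by
    rw [hx1, Real.log_pow, Real.log_exp]; norm_num
  have hr2 : (2 * a + 1) * S = l * Real.exp l := by
    rw [← hr, hE]; field_simp; ring
  have h1 : Real.log (1 + x) = x * (1 + 2 * a) / (1 + x) := by
    rw [hlog, hx1, hxS]
    field_simp
    linarith
  have h2 : (1 + x) * (1 - 2 * a) ≤ 1 + 2 * a := by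
    -- tanh l ≤ 2a
    have ht : S ≤ 2 * a * C := by
      have : l ≤ 2 * a := by linarith
      nlinarith
    have : (1 + x) * (1 - 2 * a) - (1 + 2 * a) = 2 * Real.exp l * (S - 2 * a * C) := by
      rw [hx1]; linear_combination (1/2 - a) * (hEx + hEx') + (1/2+a) * (hEx' - hEx)
    nlinarith
  refine ⟨x / 2, by positivity, fun p hp => ?_⟩
  have hphi := phi_nonneg hx (by linarith : 0 < 2 * a) h1 h2 (w := x / 2 / p) (by positivity)
  have hlogc : Real.log (1 + x / 2) = l + Real.log C := by
    have : 1 + x / 2 = Real.exp l * C := by linarith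
    rw [this, Real.log_mul hEp.ne' hC.ne', Real.log_exp]
  have hK : (p + a) * (x / 2 / p * x * (1 + 2 * a) ^ 2 / ((1 + x) * (x + 2 * a * (x / 2 / p))))
      = (1 + 2 * a) * l := by
    have : x * (1 + 2 * a) = 2 * l * (1 + x) := by
      rw [hlog] at h1; field_simp at h1; linarith
    have e1 : x + 2 * a * (x / 2 / p) = x * (p + a) / p := by field_simp
    have e2 : p + a ≠ 0 := by positivity
    have e3 : 1 + x ≠ 0 := by positivity
    rw [e1]
    field_simp
    linarith
  have : 2 * a ^ 2 + Real.log (1 + x / 2) ≤ (1 + 2 * a) * l := by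
    rw [hlogc]
    have : l * C / S - 1 = 2 * a - l := by linarith
    rw [this] at hkey
    linarith
  calc _ ≤ _ := this
    _ = _ := hK.symm
    _ ≤ _ := mul_le_mul_of_nonneg_left hphi (by positivity)

open scoped ENNReal in
lemma pi_wd {α : Type*} [MeasurableSpace α] (μ : Measure α) [IsProbabilityMeasure μ] (t : ℕ)
    (g : α → ℝ≥0∞) (hg : Measurable g) [SigmaFinite (μ.withDensity g)] :
    Measure.pi (fun _ : Fin t => μ.withDensity g)
      = (Measure.pi (fun _ : Fin t => μ)).withDensity (fun ω => ∏ k, g (ω k)) := by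
  refine Measure.pi_eq fun s hs => ?_
  rw [withDensity_apply _ (MeasurableSet.univ_pi hs), ← lintegral_indicator (MeasurableSet.univ_pi hs)]
  have h1 : ∀ ω : Fin t → α, (Set.univ.pi s).indicator (fun ω => ∏ k, g (ω k)) ω
      = ∏ k, (s k).indicator g (ω k) := by
    intro ω
    by_cases h : ω ∈ Set.univ.pi s
    · rw [Set.indicator_of_mem h]
      exact Finset.prod_congr rfl fun k _ => (Set.indicator_of_mem (h k (Set.mem_univ k)) g).symm
    · rw [Set.indicator_of_notMem h]
      simp only [Set.mem_pi, Set.mem_univ, true_imp_iff, not_forall] at h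
      obtain ⟨k, hk⟩ := h
      exact (Finset.prod_eq_zero (Finset.mem_univ k) (Set.indicator_of_notMem hk g)).symm
  simp_rw [h1]
  have hm : ∀ k, Measurable ((s k).indicator g) := fun k => hg.indicator (hs k)
  have hind : ProbabilityTheory.iIndepFun (fun (k : Fin t) (ω : Fin t → α) => (s k).indicator g (ω k))
      (Measure.pi (fun _ : Fin t => μ)) :=
    ProbabilityTheory.iIndepFun_pi (μ := fun _ => μ) (fun k => (hm k).aemeasurable)
  have := ProbabilityTheory.lintegral_prod_eq_prod_lintegral_of_indepFun (Finset.univ)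
    (fun (k : Fin t) (ω : Fin t → α) => (s k).indicator g (ω k)) hind
    (fun k => (hm k).comp (measurable_pi_apply k))
  rw [this]
  refine Finset.prod_congr rfl fun k _ => ?_
  rw [withDensity_apply _ (hs k), ← lintegral_indicator (hs k)]
  exact (measurePreserving_eval (fun _ : Fin t => μ) k).lintegral_comp (hm k)

open scoped ENNReal in
lemma wd_apply {α : Type*} [MeasurableSpace α] (μ : Measure α)
    (d : ℝ≥0∞) (A : Set α) (hA : MeasurableSet A) (s : Set α) (hs : MeasurableSet s) :
    μ.withDensity (fun x => 1 + d * A.indicator 1 x) s = μ s + d * μ (A ∩ s) := by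
  rw [withDensity_apply _ hs, lintegral_add_left measurable_const, lintegral_const_mul _
    (measurable_one.indicator hA), lintegral_indicator_one hA, Measure.restrict_apply hA]
  simp

open scoped ENNReal in
lemma chain_max {α ι : Type*} [MeasurableSpace α] [LinearOrder ι] (μ : Measure α)
    [IsProbabilityMeasure μ] (t : ℕ) (A : ι → Set α) (hanti : Antitone A)
    (hA : ∀ i, MeasurableSet (A i)) (c B : ℝ≥0∞) (hc : c ≠ ∞) (s : Finset ι)
    (hpos : ∀ i ∈ s, μ (A i) ≠ 0) (C : ι → Set (Fin t → α)) (hC : ∀ i, MeasurableSet (C i))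
    (hdep : ∀ i ω ω', (∀ k, ω k ∈ A i ↔ ω' k ∈ A i) → (ω ∈ C i ↔ ω' ∈ C i))
    (hB : ∀ i ∈ s, ∀ ω ∈ C i, B ≤ ∏ k, (1 + c / μ (A i) * (A i).indicator 1 (ω k))) :
    B * Measure.pi (fun _ : Fin t => μ) (⋃ i ∈ s, C i) ≤ (1 + c) ^ t := by
  classical
  rcases s.eq_empty_or_nonempty with rfl | hne
  · simp
  set m := s.max' hne
  have hms : m ∈ s := s.max'_mem hne
  obtain ⟨z, hz⟩ : (A m).Nonempty := nonempty_of_measure_ne_zero (hpos m hms)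
  set κ : ι → Measure α := fun i => μ.withDensity (fun x => 1 + c / μ (A i) * (A i).indicator 1 x)
    with hκ
  have hκa : ∀ i, ∀ S, MeasurableSet S → κ i S = μ S + c / μ (A i) * μ (A i ∩ S) :=
    fun i S hS => wd_apply μ _ _ (hA i) S hS
  have hκu : ∀ i ∈ s, κ i Set.univ = 1 + c := by
    intro i hi
    rw [hκa i _ MeasurableSet.univ, Set.inter_univ, measure_univ,
      ENNReal.div_mul_cancel (hpos i hi) (measure_ne_top _ _)]
  have hfin : ∀ i ∈ s, IsFiniteMeasure (κ i) := fun i hi =>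
    ⟨by rw [hκu i hi]; exact ENNReal.add_lt_top.2 ⟨ENNReal.one_lt_top, hc.lt_top⟩⟩
  set E : ι → Set (Fin t → α) := fun i => C i \ ⋃ j ∈ s.filter (· < i), C j with hE
  have hEm : ∀ i, MeasurableSet (E i) := fun i =>
    (hC i).diff (Finset.measurableSet_biUnion _ fun j _ => hC j)
  have hcov : (⋃ i ∈ s, C i) ⊆ ⋃ i ∈ s, E i := by
    intro ω hω
    simp only [Set.mem_iUnion, exists_prop] at hω
    obtain ⟨i, his, hi⟩ := hω
    have hn : (s.filter (fun i => ω ∈ C i)).Nonempty := ⟨i, by simp [his, hi]⟩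
    have h1 := Finset.min'_mem _ hn
    set j := (s.filter (fun i => ω ∈ C i)).min' hn
    rw [Finset.mem_filter] at h1
    simp only [Set.mem_iUnion, exists_prop]
    refine ⟨j, h1.1, h1.2, ?_⟩
    simp only [Set.mem_iUnion, exists_prop, Finset.mem_filter, not_exists, not_and]
    intro q hq hqC
    have : j ≤ q := Finset.min'_le _ _ (by simp [hq.1, hqC])
    exact absurd hq.2 (not_lt.2 this)
  have hdisj : (s : Set ι).PairwiseDisjoint E := by
    intro i hi j hj hij
    rw [Function.onFun, Set.disjoint_left]
    intro ω h1 h2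
    rcases lt_or_gt_of_ne hij with h | h
    · exact h2.2 (Set.mem_biUnion (Finset.mem_filter.2 ⟨hi, h⟩) h1.1)
    · exact h1.2 (Set.mem_biUnion (Finset.mem_filter.2 ⟨hj, h⟩) h2.1)
  have hEdep : ∀ i ω ω', (∀ k, ∀ j ≤ i, (ω k ∈ A j ↔ ω' k ∈ A j)) → (ω ∈ E i ↔ ω' ∈ E i) := by
    intro i ω ω' h
    simp only [hE, Set.mem_sdiff, Set.mem_iUnion, exists_prop, Finset.mem_filter, not_exists,
      not_and]
    refine and_congr (hdep i ω ω' fun k => h k i le_rfl) (forall_congr' fun j => ?_)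
    refine forall_congr' fun hj => not_congr (hdep j ω ω' fun k => h k j hj.2.le)
  have hswap : ∀ i ∈ s, Measure.pi (fun _ : Fin t => κ i) (E i)
      = Measure.pi (fun _ : Fin t => κ m) (E i) := by
    intro i hi
    have him : i ≤ m := s.le_max' i hi
    have hsub : A m ⊆ A i := hanti him
    have := hfin i hi
    have := hfin m hms
    set ρ : α → α := (A i).piecewise (fun _ => z) id with hρ
    have hρm : Measurable ρ := Measurable.piecewise (hA i) measurable_const measurable_id
    have hρA : ∀ j ≤ i, ∀ x, ρ x ∈ A j ↔ x ∈ A j := by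
      intro j hj x
      by_cases hx : x ∈ A i
      · have : ρ x = z := Set.piecewise_eq_of_mem _ _ _ hx
        rw [this]
        exact ⟨fun _ => hanti hj hx, fun _ => hanti hj (hsub hz)⟩
      · have : ρ x = x := Set.piecewise_eq_of_notMem _ _ _ hx
        rw [this]
    have hpre : (fun (x : Fin t → α) k => ρ (x k)) ⁻¹' (E i) = E i := by
      ext ω
      exact hEdep i _ _ fun k j hj => hρA j hj (ω k)
    have hmeas : Measurable (fun (x : Fin t → α) k => ρ (x k)) :=
      measurable_pi_lambda _ fun k => hρm.comp (measurable_pi_apply k)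
    have hmap : (κ i).map ρ = (κ m).map ρ := by
      ext S hS
      rw [Measure.map_apply hρm hS, Measure.map_apply hρm hS, hκa i _ (hρm hS), hκa m _ (hρm hS)]
      congr 1
      by_cases hzS : z ∈ S
      · have h1 : A i ∩ ρ ⁻¹' S = A i := by
          rw [Set.inter_eq_left]
          intro x hx
          have : ρ x = z := Set.piecewise_eq_of_mem _ _ _ hx
          simpa [this] using hzS
        have h2 : A m ∩ ρ ⁻¹' S = A m := by
          rw [Set.inter_eq_left] at h1 ⊢
          exact hsub.trans h1
        rw [h1, h2, ENNReal.div_mul_cancel (hpos i hi) (measure_ne_top _ _),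
          ENNReal.div_mul_cancel (hpos m hms) (measure_ne_top _ _)]
      · have h1 : A i ∩ ρ ⁻¹' S = ∅ := by
          rw [← Set.disjoint_iff_inter_eq_empty, Set.disjoint_left]
          intro x hx hx2
          have : ρ x = z := Set.piecewise_eq_of_mem _ _ _ hx
          rw [Set.mem_preimage, this] at hx2
          exact hzS hx2
        have h2 : A m ∩ ρ ⁻¹' S = ∅ :=
          Set.subset_empty_iff.1 (h1 ▸ Set.inter_subset_inter_left _ hsub)
        rw [h1, h2]; simp
    have e1 := Measure.pi_map_pi (μ := fun _ : Fin t => κ i) (f := fun _ => ρ)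
      (fun _ => hρm.aemeasurable)
    have e2 := Measure.pi_map_pi (μ := fun _ : Fin t => κ m) (f := fun _ => ρ)
      (fun _ => hρm.aemeasurable)
    simp only [hmap] at e1
    have e3 := e1.trans e2.symm
    have e4 := congrArg (fun M => M (E i)) e3
    simp only [Measure.map_apply hmeas (hEm i), hpre] at e4
    exact e4
  have hdens : ∀ i ∈ s, B * Measure.pi (fun _ : Fin t => μ) (E i)
      ≤ Measure.pi (fun _ : Fin t => κ i) (E i) := by
    intro i hi
    have := hfin i hi
    have hgm : Measurable (fun x => 1 + c / μ (A i) * (A i).indicator (1 : α → ℝ≥0∞) x) := (by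
      exact ((measurable_one.indicator (hA i)).const_mul _).const_add _)
    rw [pi_wd μ t _ hgm,
      withDensity_apply _ (hEm i), ← setLIntegral_const]
    exact setLIntegral_mono' (hEm i) fun ω hω => hB i hi ω hω.1
  have := hfin m hms
  calc B * Measure.pi (fun _ : Fin t => μ) (⋃ i ∈ s, C i)
      ≤ B * ∑ i ∈ s, Measure.pi (fun _ : Fin t => μ) (E i) := by
        gcongr
        exact (measure_mono hcov).trans (measure_biUnion_finset_le _ _)
    _ = ∑ i ∈ s, B * Measure.pi (fun _ : Fin t => μ) (E i) := Finset.mul_sum _ _ _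
    _ ≤ ∑ i ∈ s, Measure.pi (fun _ : Fin t => κ m) (E i) :=
        Finset.sum_le_sum fun i hi => (hdens i hi).trans_eq (hswap i hi)
    _ = Measure.pi (fun _ : Fin t => κ m) (⋃ i ∈ s, E i) :=
        (measure_biUnion_finset hdisj fun i _ => hEm i).symm
    _ ≤ Measure.pi (fun _ : Fin t => κ m) Set.univ := measure_mono (Set.subset_univ _)
    _ = (1 + c) ^ t := by
        rw [Measure.pi_univ]; simp [hκu m hms]

open scoped ENNReal in
lemma one_sided {α ι : Type*} [MeasurableSpace α] [LinearOrder ι] [Countable ι] (μ : Measure α)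
    [IsProbabilityMeasure μ] (t : ℕ) (ht : 0 < t) (A : ι → Set α) (hanti : Antitone A)
    (hA : ∀ i, MeasurableSet (A i)) (a : ℝ) (ha : 0 < a) :
    Measure.pi (fun _ : Fin t => μ)
      (⋃ i, {ω | t * ((μ (A i)).toReal + a) ≤ ∑ k, (A i).indicator (fun _ => (1:ℝ)) (ω k)})
      ≤ ENNReal.ofReal (Real.exp (-2 * t * a ^ 2)) := by
  classical
  set C : ι → Set (Fin t → α) := fun i =>
    {ω | t * ((μ (A i)).toReal + a) ≤ ∑ k, (A i).indicator (fun _ => (1:ℝ)) (ω k)} with hCdef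
  have ht' : (0:ℝ) < t := by exact_mod_cast ht
  have hC : ∀ i, MeasurableSet (C i) := fun i => by
    apply measurableSet_le measurable_const
    exact Finset.measurable_sum _ fun k _ =>
      (measurable_const.indicator (hA i)).comp (measurable_pi_apply k)
  have hdep : ∀ i ω ω', (∀ k, ω k ∈ A i ↔ ω' k ∈ A i) → (ω ∈ C i ↔ ω' ∈ C i) := by
    intro i ω ω' h
    simp only [hCdef, Set.mem_ofPred_eq]
    have : ∀ k, (A i).indicator (fun _ => (1:ℝ)) (ω k) = (A i).indicator (fun _ => (1:ℝ)) (ω' k) := by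
      intro k
      simp only [Set.indicator_apply, h k]
    simp only [this]
  have hnull : ∀ i, μ (A i) = 0 → Measure.pi (fun _ : Fin t => μ) (C i) = 0 := by
    intro i hi
    have hsub : C i ⊆ ⋃ k, Function.eval k ⁻¹' (A i) := by
      intro ω hω
      by_contra hcon
      simp only [Set.mem_iUnion, not_exists, Set.mem_preimage, Function.eval] at hcon
      simp only [hCdef, Set.mem_ofPred_eq, Set.indicator_of_notMem (hcon _), hi] at hω
      simp at hω
      nlinarith
    refine measure_mono_null hsub (measure_iUnion_null fun k => ?_)
    exact Measure.pi_eval_preimage_null _ hi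
  obtain ⟨c, hc, hcp⟩ := exists_c ha
  have hfinset : ∀ s : Finset ι, (∀ i ∈ s, μ (A i) ≠ 0) →
      Measure.pi (fun _ : Fin t => μ) (⋃ i ∈ s, C i) ≤ ENNReal.ofReal (Real.exp (-2 * t * a ^ 2)) := by
    intro s hs
    have hmain := chain_max μ t A hanti hA (ENNReal.ofReal c)
      (ENNReal.ofReal (Real.exp (t * (2 * a ^ 2 + Real.log (1 + c))))) ENNReal.ofReal_ne_top s hs C hC
      hdep (by
        intro i hi ω hω
        set p := (μ (A i)).toReal with hp
        have hp0 : 0 < p := ENNReal.toReal_pos (hs i hi) (measure_ne_top _ _)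
        have hpe : μ (A i) = ENNReal.ofReal p := (ENNReal.ofReal_toReal (measure_ne_top _ _)).symm
        have hterm : ∀ k, (1 + ENNReal.ofReal c / μ (A i) * (A i).indicator 1 (ω k))
            = ENNReal.ofReal (Real.exp ((A i).indicator (fun _ => (1:ℝ)) (ω k)
                * Real.log (1 + c / p))) := by
          intro k
          by_cases hk : ω k ∈ A i
          · rw [Set.indicator_of_mem hk, Set.indicator_of_mem hk, one_mul,
              Real.exp_log (by positivity), hpe, ← ENNReal.ofReal_div_of_pos hp0,
              ENNReal.ofReal_add zero_le_one (by positivity)]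
            simp
          · rw [Set.indicator_of_notMem hk, Set.indicator_of_notMem hk]
            simp
        simp only [hterm]
        rw [← ENNReal.ofReal_prod_of_nonneg (fun _ _ => (Real.exp_pos _).le), ← Real.exp_sum,
          ← Finset.sum_mul]
        apply ENNReal.ofReal_le_ofReal
        apply Real.exp_le_exp.2
        have hL : 0 ≤ Real.log (1 + c / p) := Real.log_nonneg (by
          have : 0 ≤ c / p := by positivity
          linarith)
        calc t * (2 * a ^ 2 + Real.log (1 + c)) ≤ t * ((p + a) * Real.log (1 + c / p)) :=
              mul_le_mul_of_nonneg_left (hcp p hp0) ht'.le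
          _ = (t * (p + a)) * Real.log (1 + c / p) := by ring
          _ ≤ _ := mul_le_mul_of_nonneg_right hω hL)
    have h1c : (1 + ENNReal.ofReal c) ^ t = ENNReal.ofReal (Real.exp (t * Real.log (1 + c))) := by
      rw [← Real.log_pow, Real.exp_log (by positivity), ENNReal.ofReal_pow (by positivity),
        ENNReal.ofReal_add zero_le_one hc.le, ENNReal.ofReal_one]
    rw [h1c] at hmain
    have e : Real.exp (t * Real.log (1 + c)) = Real.exp (t * (2 * a ^ 2 + Real.log (1 + c)))
        * Real.exp (-2 * t * a ^ 2) := by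
      rw [← Real.exp_add]; ring_nf
    rw [e, ENNReal.ofReal_mul (Real.exp_pos _).le] at hmain
    exact (ENNReal.mul_le_mul_iff_right (by simpa using Real.exp_pos _) ENNReal.ofReal_ne_top).1 hmain
  have hall : ∀ s : Finset ι, Measure.pi (fun _ : Fin t => μ) (⋃ i ∈ s, C i)
      ≤ ENNReal.ofReal (Real.exp (-2 * t * a ^ 2)) := by
    intro s
    have hsub : (⋃ i ∈ s, C i) ⊆ (⋃ i ∈ s.filter (fun i => μ (A i) ≠ 0), C i) ∪
        (⋃ i ∈ s.filter (fun i => μ (A i) = 0), C i) := by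
      intro ω hω
      simp only [Set.mem_iUnion, exists_prop] at hω
      obtain ⟨i, hi, hω⟩ := hω
      by_cases h : μ (A i) = 0
      · exact Or.inr (Set.mem_biUnion (Finset.mem_filter.2 ⟨hi, h⟩) hω)
      · exact Or.inl (Set.mem_biUnion (Finset.mem_filter.2 ⟨hi, h⟩) hω)
    have hz : Measure.pi (fun _ : Fin t => μ) (⋃ i ∈ s.filter (fun i => μ (A i) = 0), C i) = 0 := by
      refine le_antisymm ((measure_biUnion_finset_le _ _).trans_eq ?_) (by simp)
      exact Finset.sum_eq_zero fun i hi => hnull i (Finset.mem_filter.1 hi).2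
    refine (measure_mono hsub).trans ((measure_union_le _ _).trans ?_)
    rw [hz, add_zero]
    exact hfinset _ fun i hi => (Finset.mem_filter.1 hi).2
  have hU : (⋃ i, C i) = ⋃ s : Finset ι, ⋃ i ∈ s, C i := by
    ext ω
    simp only [Set.mem_iUnion, exists_prop]
    exact ⟨fun ⟨i, hi⟩ => ⟨{i}, i, by simp, hi⟩, fun ⟨_, i, _, hi⟩ => ⟨i, hi⟩⟩
  rw [hU, Directed.measure_iUnion]
  · exact iSup_le hall
  · apply Monotone.directed_le
    intro s s' hss
    exact Set.biUnion_subset_biUnion_left hss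

lemma empirical_bd {t : ℕ} (ω : Fin t → ℝ) (x : ℝ) :
    0 ≤ empiricalCdf ω x ∧ empiricalCdf ω x ≤ 1 := by
  unfold empiricalCdf
  constructor
  · exact div_nonneg (Finset.sum_nonneg fun i _ => by split_ifs <;> simp) (Nat.cast_nonneg t)
  · apply div_le_one_of_le₀ _ (Nat.cast_nonneg t)
    calc _ ≤ ∑ s : Fin t, (1:ℝ) := Finset.sum_le_sum fun i _ => by split_ifs <;> simp
      _ = t := by simp

lemma cdfOf_bd (μ : ProbabilityMeasure ℝ) (x : ℝ) :
    0 ≤ cdfOf μ x ∧ cdfOf μ x ≤ 1 :=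
  ⟨ENNReal.toReal_nonneg, by
    have := ENNReal.toReal_mono ENNReal.one_ne_top (prob_le_one (μ := (μ : Measure ℝ)) (s := Set.Iic x))
    rw [ENNReal.toReal_one] at this
    exact this⟩

lemma bdd_diff {t : ℕ} (μ : ProbabilityMeasure ℝ) (ω : Fin t → ℝ) :
    BddAbove (Set.range fun x => |empiricalCdf ω x - cdfOf μ x|) := by
  refine ⟨1, ?_⟩
  rintro _ ⟨x, rfl⟩
  have h1 := empirical_bd ω x
  have h2 := cdfOf_bd μ x
  exact abs_le.2 ⟨by linarith, by linarith⟩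

lemma cdfOf_tendsto (μ : ProbabilityMeasure ℝ) (x : ℝ) :
    Filter.Tendsto (cdfOf μ) (nhdsWithin x (Set.Ioi x)) (nhds (cdfOf μ x)) := by
  have h : cdfOf μ = ProbabilityTheory.cdf (μ : Measure ℝ) := by
    ext y
    rw [ProbabilityTheory.cdf_eq_real]; rfl
  rw [h]
  have := (ProbabilityTheory.cdf (μ : Measure ℝ)).right_continuous x
  exact (this.mono Set.Ioi_subset_Ici_self).tendsto

lemma empirical_eventually {t : ℕ} (ω : Fin t → ℝ) (x : ℝ) :
    ∀ᶠ y in nhdsWithin x (Set.Ioi x), empiricalCdf ω y = empiricalCdf ω x := by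
  have : ∀ k : Fin t, ∀ᶠ y in nhdsWithin x (Set.Ioi x),
      ((if ω k ≤ y then (1:ℝ) else 0) = if ω k ≤ x then (1:ℝ) else 0) := by
    intro k
    by_cases hk : ω k ≤ x
    · filter_upwards [self_mem_nhdsWithin] with y hy
      have hy' : x < y := hy
      rw [if_pos hk, if_pos (hk.trans hy'.le)]
    · filter_upwards [Ioo_mem_nhdsGT (not_le.1 hk)] with y hy
      rw [if_neg hk, if_neg (not_le.2 hy.2)]
  filter_upwards [Filter.eventually_all.2 this] with y hy
  simp only [empiricalCdf, hy]

lemma supDist_lt_iff {t : ℕ} (μ : ProbabilityMeasure ℝ) (ω : Fin t → ℝ) (a : ℝ) :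
    a < supDist (empiricalCdf ω) (cdfOf μ) ↔
      ∃ q : ℚ, a < |empiricalCdf ω q - cdfOf μ q| := by
  constructor
  · intro h
    obtain ⟨x, hx⟩ := exists_lt_of_lt_ciSup h
    have h1 : Filter.Tendsto (fun y => |empiricalCdf ω x - cdfOf μ y|)
        (nhdsWithin x (Set.Ioi x)) (nhds (|empiricalCdf ω x - cdfOf μ x|)) :=
      (tendsto_const_nhds.sub (cdfOf_tendsto μ x)).abs
    have h2 := (h1.eventually_const_lt hx).and (empirical_eventually ω x)
    obtain ⟨u, hu, hu2⟩ := (mem_nhdsGT_iff_exists_Ioo_subset).1 h2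
    obtain ⟨q, hq1, hq2⟩ := exists_rat_btwn (show x < u from hu)
    have := hu2 ⟨hq1, hq2⟩
    refine ⟨q, ?_⟩
    have h3 : a < |empiricalCdf ω x - cdfOf μ q| ∧ empiricalCdf ω q = empiricalCdf ω x := this
    rw [h3.2]; exact h3.1
  · rintro ⟨q, hq⟩
    exact hq.trans_le (le_ciSup (bdd_diff μ ω) (q : ℝ))

lemma measurable_emp {t : ℕ} (x : ℝ) : Measurable (fun ω : Fin t → ℝ => empiricalCdf ω x) := by
  unfold empiricalCdf
  refine Measurable.div_const (Finset.measurable_sum _ fun k _ => ?_) _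
  exact Measurable.ite (measurableSet_le (measurable_pi_apply k) measurable_const)
    measurable_const measurable_const

lemma measurable_supDist {t : ℕ} (μ : ProbabilityMeasure ℝ) :
    Measurable (fun ω : Fin t → ℝ => supDist (empiricalCdf ω) (cdfOf μ)) := by
  apply measurable_of_Ioi
  intro a
  have : (fun ω : Fin t → ℝ => supDist (empiricalCdf ω) (cdfOf μ)) ⁻¹' Set.Ioi a
      = ⋃ q : ℚ, {ω | a < |empiricalCdf ω q - cdfOf μ q|} := by
    ext ω
    simp only [Set.mem_iUnion]
    exact supDist_lt_iff μ ω a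
  rw [this]
  refine MeasurableSet.iUnion fun q => measurableSet_lt measurable_const ?_
  have := ((measurable_emp (t := t) (q:ℝ)).sub_const (cdfOf μ q))
  exact continuous_abs.measurable.comp this

lemma supDist_nonneg {t : ℕ} (μ : ProbabilityMeasure ℝ) (ω : Fin t → ℝ) :
    0 ≤ supDist (empiricalCdf ω) (cdfOf μ) := Real.iSup_nonneg fun _ => abs_nonneg _

lemma dkwm (μ : ProbabilityMeasure ℝ) (t : ℕ) (ht : 0 < t) (a : ℝ) (ha : 0 < a) :
    Measure.pi (fun _ : Fin t => (μ : Measure ℝ))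
      {ω | a < supDist (empiricalCdf ω) (cdfOf μ)}
      ≤ ENNReal.ofReal (2 * Real.exp (-2 * t * a ^ 2)) := by
  have ht' : (0:ℝ) < t := by exact_mod_cast ht
  have : Countable ℚᵒᵈ := OrderDual.ofDual.injective.countable
  have h1 := one_sided (ι := ℚᵒᵈ) (μ : Measure ℝ) t ht (fun q => Set.Iic ((OrderDual.ofDual q : ℚ) : ℝ))
    (fun q q' h => Set.Iic_subset_Iic.2 (by exact_mod_cast h)) (fun _ => measurableSet_Iic) a ha
  have h2 := one_sided (ι := ℚ) (μ : Measure ℝ) t ht (fun q => Set.Ioi (q : ℝ))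
    (fun q q' h => Set.Ioi_subset_Ioi (by exact_mod_cast h)) (fun _ => measurableSet_Ioi) a ha
  have hadd : ENNReal.ofReal (2 * Real.exp (-2 * t * a ^ 2)) =
      ENNReal.ofReal (Real.exp (-2 * t * a ^ 2)) + ENNReal.ofReal (Real.exp (-2 * t * a ^ 2)) := by
    rw [← ENNReal.ofReal_add (Real.exp_pos _).le (Real.exp_pos _).le]; ring_nf
  rw [hadd]
  refine (measure_mono ?_).trans ((measure_union_le _ _).trans (add_le_add h1 h2))
  intro ω hω
  obtain ⟨q, hq⟩ := (supDist_lt_iff μ ω a).1 hω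
  have hs : ∑ k, (Set.Iic (q:ℝ)).indicator (fun _ => (1:ℝ)) (ω k) = t * empiricalCdf ω q := by
    unfold empiricalCdf
    rw [mul_div_cancel₀ _ ht'.ne']
    rfl
  rcases lt_abs.1 hq with h | h
  · left
    refine Set.mem_iUnion.2 ⟨OrderDual.toDual q, ?_⟩
    change t * (cdfOf μ q + a) ≤ ∑ k, (Set.Iic (q:ℝ)).indicator (fun _ => (1:ℝ)) (ω k)
    rw [hs]
    exact mul_le_mul_of_nonneg_left (by linarith) ht'.le
  · right
    refine Set.mem_iUnion.2 ⟨q, ?_⟩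
    have e1 : ((μ : Measure ℝ) (Set.Ioi (q:ℝ))).toReal = 1 - cdfOf μ q := by
      have := probReal_compl_eq_one_sub (μ := (μ : Measure ℝ)) (measurableSet_Iic (a := (q:ℝ)))
      rw [Set.compl_Iic] at this
      exact this
    have e2 : ∑ k, (Set.Ioi (q:ℝ)).indicator (fun _ => (1:ℝ)) (ω k) = t - t * empiricalCdf ω q := by
      rw [← hs, eq_sub_iff_add_eq, ← Finset.sum_add_distrib]
      have : ∀ k, (Set.Ioi (q:ℝ)).indicator (fun _ => (1:ℝ)) (ω k)
        + (Set.Iic (q:ℝ)).indicator (fun _ => (1:ℝ)) (ω k) = 1 := by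
        intro k
        by_cases hk : ω k ≤ q
        · simp [hk]
        · simp [hk, not_le.1 hk]
      simp [this]
    change t * (((μ : Measure ℝ) (Set.Ioi (q:ℝ))).toReal + a) ≤ _
    rw [e1, e2]
    have := mul_le_mul_of_nonneg_left (show 1 - cdfOf μ q + a ≤ 1 - empiricalCdf ω q by linarith) ht'.le
    linarith

lemma first_bound (μ : ProbabilityMeasure ℝ) (t : ℕ) (ht : 0 < t) (s : ℝ) (hs : 0 < s) :
    (∫⁻ ω : Fin t → ℝ,
          ENNReal.ofReal (Real.exp (s * t * supDist (empiricalCdf ω) (cdfOf μ)))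
        ∂(Measure.pi fun _ : Fin t => (μ : Measure ℝ))
      ≤ ENNReal.ofReal
          (1 + Real.sqrt (2 * Real.pi) * s * Real.sqrt t * Real.exp (s ^ 2 * t / 8))) := by
  have ht' : (0:ℝ) < t := by exact_mod_cast ht
  set P := Measure.pi fun _ : Fin t => (μ : Measure ℝ)
  set f : (Fin t → ℝ) → ℝ := fun ω => s * t * supDist (empiricalCdf ω) (cdfOf μ) with hf
  have hf0 : ∀ ω, 0 ≤ f ω := fun ω => mul_nonneg (by positivity) (supDist_nonneg μ ω)
  have hfm : Measurable f := (measurable_supDist μ).const_mul _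
  have hlc := lintegral_comp_eq_lintegral_meas_lt_mul P (Filter.Eventually.of_forall hf0)
    hfm.aemeasurable (g := Real.exp) (fun _ _ => Real.continuous_exp.intervalIntegrable _ _)
    (Filter.Eventually.of_forall fun _ => (Real.exp_pos _).le)
  have hpt : ∀ ω, ENNReal.ofReal (Real.exp (f ω))
      = 1 + ENNReal.ofReal (∫ u in (0:ℝ)..f ω, Real.exp u) := by
    intro ω
    have h1 : 1 ≤ Real.exp (f ω) := Real.one_le_exp (hf0 ω)
    rw [integral_exp, Real.exp_zero, ← ENNReal.ofReal_one,
      ← ENNReal.ofReal_add zero_le_one (by linarith)]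
    ring_nf
  set b : ℝ := 2 / (s ^ 2 * t) with hb
  have hbp : 0 < b := by positivity
  set h : ℝ → ℝ := fun u => 2 * Real.exp (s ^ 2 * t / 8) * Real.exp (-b * (u - s ^ 2 * t / 4) ^ 2)
    with hh
  have hint : Integrable h :=
    ((integrable_exp_neg_mul_sq hbp).comp_sub_right (s ^ 2 * t / 4)).const_mul _
  have hval : ∫ u, h u = Real.sqrt (2 * Real.pi) * s * Real.sqrt t * Real.exp (s ^ 2 * t / 8) := by
    simp only [hh]
    rw [integral_const_mul, integral_sub_right_eq_self (fun u => Real.exp (-b * u ^ 2)),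
      integral_gaussian]
    have : Real.sqrt (2 * Real.pi) * s * Real.sqrt t = 2 * Real.sqrt (Real.pi / b) := by
      have e : Real.pi / b = (2 * Real.pi) * t * (s / 2) ^ 2 := by rw [hb]; field_simp
      rw [e, Real.sqrt_mul (by positivity) ((s / 2) ^ 2), Real.sqrt_mul (by positivity) (t : ℝ),
        Real.sqrt_sq (by positivity)]
      ring
    rw [this]; ring
  have htail : ∫⁻ u in Set.Ioi (0:ℝ), P {ω | u < f ω} * ENNReal.ofReal (Real.exp u)
      ≤ ∫⁻ u, ENNReal.ofReal (h u) := by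
    refine le_trans (setLIntegral_mono' measurableSet_Ioi ?_) (setLIntegral_le_lintegral _ _)
    intro u hu
    have hu' : 0 < u := hu
    have hset : {ω | u < f ω} = {ω | u / (s * t) < supDist (empiricalCdf ω) (cdfOf μ)} := by
      ext ω
      change u < f ω ↔ u / (s * t) < _
      rw [div_lt_iff₀ (by positivity), hf, mul_comm (supDist _ _)]
    rw [hset]
    refine (mul_le_mul_left (dkwm μ t ht _ (by positivity)) _).trans_eq ?_
    rw [← ENNReal.ofReal_mul (by positivity)]
    congr 1
    simp only [hh]
    rw [mul_assoc 2, mul_assoc 2, ← Real.exp_add, ← Real.exp_add]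
    congr 2
    rw [hb]; field_simp; ring
  calc ∫⁻ ω, ENNReal.ofReal (Real.exp (f ω)) ∂P
      = 1 + ∫⁻ ω, ENNReal.ofReal (∫ u in (0:ℝ)..f ω, Real.exp u) ∂P := by
        simp only [hpt]
        rw [lintegral_add_left measurable_const]
        simp [P]
    _ ≤ 1 + ∫⁻ u, ENNReal.ofReal (h u) := by rw [hlc]; gcongr
    _ = _ := by
        rw [← ofReal_integral_eq_lintegral_ofReal hint
          (Filter.Eventually.of_forall fun u => by simp only [hh, Pi.zero_apply]; positivity), hval,
          ENNReal.ofReal_add zero_le_one (by positivity), ENNReal.ofReal_one]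

lemma second_bound (t : ℝ) (ht : 0 < t) (s : ℝ) (hs : 0 < s) (k : ℝ) (hk : 0 < k) :
    1 + Real.sqrt (2 * Real.pi) * s * Real.sqrt t * Real.exp (s ^ 2 * t / 8) ≤
      (1 + 2 * Real.sqrt (2 * Real.pi * k / Real.exp 1))
            * Real.exp ((1 + 1 / k) * s ^ 2 * t / 8) := by
  have hsplit : Real.exp ((1 + 1 / k) * s ^ 2 * t / 8)
      = Real.exp (s ^ 2 * t / 8) * Real.exp (s ^ 2 * t / (8 * k)) := by
    rw [← Real.exp_add]; congr 1; field_simp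
  have h1 : 1 ≤ Real.exp ((1 + 1 / k) * s ^ 2 * t / 8) := Real.one_le_exp (by positivity)
  have h2 : s * Real.sqrt t ≤ 2 * Real.sqrt (k / Real.exp 1) * Real.exp (s ^ 2 * t / (8 * k)) := by
    apply le_of_sq_le_sq _ (by positivity)
    rw [mul_pow, mul_pow, mul_pow, Real.sq_sqrt ht.le, Real.sq_sqrt (by positivity)]
    have := Real.add_one_le_exp (s ^ 2 * t / (4 * k) - 1)
    rw [sub_add_cancel, Real.exp_sub] at this
    have e : Real.exp (s ^ 2 * t / (8 * k)) ^ 2 = Real.exp (s ^ 2 * t / (4 * k)) := by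
      rw [← Real.exp_nat_mul]; congr 1; field_simp; norm_num
    rw [e]
    calc s ^ 2 * t = 4 * k * (s ^ 2 * t / (4 * k)) := by field_simp
      _ ≤ 4 * k * (Real.exp (s ^ 2 * t / (4 * k)) / Real.exp 1) := by gcongr
      _ = _ := by ring
  have h3 : Real.sqrt (2 * Real.pi * k / Real.exp 1)
      = Real.sqrt (2 * Real.pi) * Real.sqrt (k / Real.exp 1) := by
    rw [mul_div_assoc, Real.sqrt_mul (by positivity)]
  rw [add_mul, one_mul]
  apply add_le_add h1
  rw [h3, hsplit]
  have := mul_le_mul_of_nonneg_left h2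
    (show 0 ≤ Real.sqrt (2 * Real.pi) * Real.exp (s ^ 2 * t / 8) by positivity)
  calc _ = _ := by ring
    _ ≤ _ := this
    _ = _ := by ring

/-- Equations (A.2) and (A.3) of the paper: for `X₁,…,X_t` i.i.d. with cdf `F` and
empirical cdf `F̂_t`, for every `s > 0`,
`E[exp(s·t·‖F̂_t − F‖_∞)] ≤ 1 + √(2π)·s·√t·e^{s²t/8}` and, for every `k > 0`,
`E[exp(s·t·‖F̂_t − F‖_∞)] ≤ (1 + 2√(2πk/e))·e^{(1+1/k)s²t/8}`. -/
theorem mgf_bound_empirical_sup_dist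
    (μ : ProbabilityMeasure ℝ) (t : ℕ) (ht : 0 < t) (s : ℝ) (hs : 0 < s) :
    (∫⁻ ω : Fin t → ℝ,
          ENNReal.ofReal (Real.exp (s * t * supDist (empiricalCdf ω) (cdfOf μ)))
        ∂(Measure.pi fun _ : Fin t => (μ : Measure ℝ))
      ≤ ENNReal.ofReal
          (1 + Real.sqrt (2 * Real.pi) * s * Real.sqrt t * Real.exp (s ^ 2 * t / 8))) ∧
    ∀ k : ℝ, 0 < k →
      ∫⁻ ω : Fin t → ℝ,
          ENNReal.ofReal (Real.exp (s * t * supDist (empiricalCdf ω) (cdfOf μ)))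
        ∂(Measure.pi fun _ : Fin t => (μ : Measure ℝ))
      ≤ ENNReal.ofReal
          ((1 + 2 * Real.sqrt (2 * Real.pi * k / Real.exp 1))
            * Real.exp ((1 + 1 / k) * s ^ 2 * t / 8)) := by
  have h1 := first_bound μ t ht s hs
  refine ⟨h1, fun k hk => h1.trans (ENNReal.ofReal_le_ofReal ?_)⟩
  exact second_bound t (by exact_mod_cast ht) s hs k hk

end TRDT
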